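/- Let U := {1, (1+i)/√2, i} (the unit directions with arguments 0, π/4, π/2). Define R(U) to be the intersection of all sets S ⊆ ℂ such that 0 ∈ S, 1 ∈ S, and for all p, q ∈ S and all u, v ∈ U with [u,v] ≠ 0 we have I_{u,v}(p,q) ∈ S. Then R(U) = {a + b·i : a, b ∈ ℤ}, the ring of Gaussian integers. -/

import Mathlib

open Complex

/-- The bracket `[x,y] = x̄·y − x·ȳ`. -/
noncomputable def bracket (x y : ℂ) : ℂ :=
  (starRingEnd ℂ) x * y - x * (starRingEnd ℂ) y

/-- The intersection operator `I_{u,v}(p,q)`. -/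
noncomputable def inter (u v p q : ℂ) : ℂ :=
  (bracket u p / bracket u v) * v + (bracket v q / bracket v u) * u

theorem bracket_eq (x y : ℂ) :
    bracket x y = ((2 * (x.re * y.im - x.im * y.re) : ℝ) : ℂ) * I := by
  apply Complex.ext
  · simp [bracket]
  · simp [bracket]
    ring

theorem bracket_div_bracket (x y z w : ℂ) :
    bracket x y / bracket z w =
      (((x.re * y.im - x.im * y.re) / (z.re * w.im - z.im * w.re) : ℝ) : ℂ) := by
  rw [bracket_eq, bracket_eq, mul_div_mul_right _ _ I_ne_zero, ← ofReal_div,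
    mul_div_mul_left _ _ two_ne_zero]

theorem bracket_self (x : ℂ) : bracket x x = 0 := by
  simp [bracket, mul_comm]

theorem inter_comm (u v p q : ℂ) : inter u v p q = inter v u q p :=
  add_comm _ _

theorem bracket_smul_left (r : ℝ) (x y : ℂ) : bracket (r * x) y = r * bracket x y := by
  simp only [bracket, map_mul, conj_ofReal]; ring

theorem bracket_smul_right (r : ℝ) (x y : ℂ) : bracket x (r * y) = r * bracket x y := by
  simp only [bracket, map_mul, conj_ofReal]; ring

/-- The intersection operator depends on the second direction only up to a real scalar. -/
theorem inter_smul_right {r : ℝ} (hr : r ≠ 0) (u v p q : ℂ) :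
    inter u (r * v) p q = inter u v p q := by
  have hr' : (r : ℂ) ≠ 0 := ofReal_ne_zero.mpr hr
  simp only [inter, bracket_smul_left, bracket_smul_right]
  rw [mul_div_mul_left _ _ hr']
  congr 1
  field_simp

theorem diagonal_eq_smul :
    (1 + I) / (Real.sqrt 2 : ℂ) = (((Real.sqrt 2)⁻¹ : ℝ) : ℂ) * (1 + I) := by
  rw [ofReal_inv, div_eq_inv_mul]

theorem inter_one_I (a b c d : ℤ) :
    inter 1 I (a + b * I) (c + d * I) = c + b * I := by
  simp only [inter, bracket_div_bracket]
  apply Complex.ext <;> simp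

theorem inter_one_diagonal (a b c d : ℤ) :
    inter 1 ((1 + I) / Real.sqrt 2) (a + b * I) (c + d * I) = (c + b - d : ℤ) + b * I := by
  rw [diagonal_eq_smul, inter_smul_right (by positivity)]
  simp only [inter, bracket_div_bracket]
  apply Complex.ext <;> simp [-ofReal_div, -ofReal_sub, -ofReal_neg]
  ring

theorem inter_I_diagonal (a b c d : ℤ) :
    inter I ((1 + I) / Real.sqrt 2) (a + b * I) (c + d * I) = a + (d + a - c : ℤ) * I := by
  rw [diagonal_eq_smul, inter_smul_right (by positivity)]
  simp only [inter, bracket_div_bracket]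
  apply Complex.ext <;> simp
  ring

theorem bracket_one_I_ne_zero : bracket 1 I ≠ 0 := by
  simp [bracket_eq]

theorem bracket_one_diagonal_ne_zero : bracket 1 ((1 + I) / Real.sqrt 2) ≠ 0 := by
  rw [diagonal_eq_smul, bracket_smul_right]
  simp [bracket_eq]

theorem bracket_I_diagonal_ne_zero : bracket I ((1 + I) / Real.sqrt 2) ≠ 0 := by
  rw [diagonal_eq_smul, bracket_smul_right]
  simp [bracket_eq]

/-- A set of lattice points closed under intersecting horizontal, vertical and diagonal lines,
and containing `(0, 0)` and `(1, 0)`, is the whole lattice. -/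
theorem lattice_mem_of_closed (P : ℤ → ℤ → Prop) (h0 : P 0 0) (h1 : P 1 0)
    (hHV : ∀ a b c d, P a b → P c d → P c b)
    (hHD : ∀ a b c d, P a b → P c d → P (c + b - d) b)
    (hVD : ∀ a b c d, P a b → P c d → P a (d + a - c)) (a b : ℤ) : P a b := by
  have hvert : ∀ a, P a 0 → P 0 a := fun a ha => by
    have h := hVD _ _ _ _ ha h0
    simpa using hHV _ _ _ _ h h0
  have hneg : ∀ a, P a 0 → P (-a) 0 := fun a ha => by
    have h := hHD _ _ _ _ h0 (hvert a ha)
    simpa using h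
  have hadd : ∀ a b, P a 0 → P b 0 → P (a + b) 0 := fun a b ha hb => by
    have h := hHD _ _ _ _ (hvert b hb) ha
    simpa using hHV _ _ _ _ h0 h
  have hall : ∀ a, P a 0 := fun a => by
    induction a using Int.induction_on with
    | zero => exact h0
    | succ n ih => exact hadd _ _ ih h1
    | pred n ih => exact hadd _ _ ih (hneg _ h1)
  exact hHV _ _ _ _ (hvert b (hall b)) (hall a)

theorem stmt_12
    (U : Set ℂ) (hU : U = {1, (1 + Complex.I) / Real.sqrt 2, Complex.I}) :
    ⋂₀ {S : Set ℂ | (0 : ℂ) ∈ S ∧ (1 : ℂ) ∈ S ∧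
        ∀ p ∈ S, ∀ q ∈ S, ∀ u ∈ U, ∀ v ∈ U,
          bracket u v ≠ 0 → inter u v p q ∈ S}
      = {z : ℂ | ∃ a b : ℤ, z = (a : ℂ) + (b : ℂ) * Complex.I} := by
  subst hU
  apply Set.Subset.antisymm
  · apply Set.sInter_subset_of_mem
    refine ⟨⟨0, 0, by simp⟩, ⟨1, 0, by simp⟩, ?_⟩
    rintro _ ⟨a, b, rfl⟩ _ ⟨c, d, rfl⟩ u hu v hv huv
    simp only [Set.mem_insert_iff, Set.mem_singleton_iff] at hu hv
    rcases hu with rfl | rfl | rfl <;> rcases hv with rfl | rfl | rfl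
    · exact absurd (bracket_self _) huv
    · exact ⟨_, _, inter_one_diagonal a b c d⟩
    · exact ⟨_, _, inter_one_I a b c d⟩
    · exact ⟨_, _, (inter_comm _ _ _ _).trans (inter_one_diagonal c d a b)⟩
    · exact absurd (bracket_self _) huv
    · exact ⟨_, _, (inter_comm _ _ _ _).trans (inter_I_diagonal c d a b)⟩
    · exact ⟨_, _, (inter_comm _ _ _ _).trans (inter_one_I c d a b)⟩
    · exact ⟨_, _, inter_I_diagonal a b c d⟩
    · exact absurd (bracket_self _) huv
  · rintro _ ⟨a, b, rfl⟩ S ⟨h0, h1, hS⟩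
    refine lattice_mem_of_closed (fun a b => (a : ℂ) + (b : ℂ) * I ∈ S) (by simpa using h0)
      (by simpa using h1) ?_ ?_ ?_ a b
    · intro a b c d hp hq
      rw [← inter_one_I a b c d]
      exact hS _ hp _ hq _ (by simp) _ (by simp) bracket_one_I_ne_zero
    · intro a b c d hp hq
      rw [← inter_one_diagonal a b c d]
      exact hS _ hp _ hq _ (by simp) _ (by simp) bracket_one_diagonal_ne_zero
    · intro a b c d hp hq
      rw [← inter_I_diagonal a b c d]
      exact hS _ hp _ hq _ (by simp) _ (by simp) bracket_I_diagonal_ne_zero
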